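/- (Invertibility of the moment system matrix.) For every integer N ≥ 2 and all real numbers 𝕊, 𝕋, the 4×4 real matrix A with rows (1/N, N/(N−1), 1/(N−1), 0), (1/N, 2/(N−1), 1, 0), (1/(N−1), 0, 0, (N+1)/(N−1)), (𝕊, 2𝕋, 𝕋, 0) has determinant det A = −(N+1)(N−2)K / (N (N−1)²), where K = (N + 2 + 2/(N−1)) 𝕊 − 3 𝕋. In particular, for N ≥ 3 and K ≠ 0, A is invertible. -/

import Mathlib

open Matrix

/-- (Invertibility of the moment system matrix.) For every integer `N ≥ 2` and all real
`𝕊, 𝕋`, the 4×4 matrix `A` with rows `(1/N, N/(N−1), 1/(N−1), 0)`, `(1/N, 2/(N−1), 1, 0)`,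
`(1/(N−1), 0, 0, (N+1)/(N−1))`, `(𝕊, 2𝕋, 𝕋, 0)` has determinant
`det A = −(N+1)(N−2)K/(N(N−1)²)` where `K = (N + 2 + 2/(N−1))𝕊 − 3𝕋`; in particular,
for `N ≥ 3` and `K ≠ 0`, `A` is invertible. -/
theorem stmt_13 (N : ℕ) (hN : 2 ≤ N) (𝕊 𝕋 K : ℝ)
    (hK : K = ((N : ℝ) + 2 + 2 / ((N : ℝ) - 1)) * 𝕊 - 3 * 𝕋)
    (A : Matrix (Fin 4) (Fin 4) ℝ)
    (hA : A = !![1 / (N : ℝ), (N : ℝ) / ((N : ℝ) - 1), 1 / ((N : ℝ) - 1), 0;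
                 1 / (N : ℝ), 2 / ((N : ℝ) - 1), 1, 0;
                 1 / ((N : ℝ) - 1), 0, 0, ((N : ℝ) + 1) / ((N : ℝ) - 1);
                 𝕊, 2 * 𝕋, 𝕋, 0]) :
    A.det = -((N : ℝ) + 1) * ((N : ℝ) - 2) * K / ((N : ℝ) * ((N : ℝ) - 1) ^ 2) ∧
      (3 ≤ N → K ≠ 0 → IsUnit A) := by
  have hN' : (2 : ℝ) ≤ N := by exact_mod_cast hN
  have h0 : (N : ℝ) ≠ 0 := by linarith
  have h1 : (N : ℝ) - 1 ≠ 0 := by linarith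
  have hdet : A.det =
      -((N : ℝ) + 1) * ((N : ℝ) - 2) * K / ((N : ℝ) * ((N : ℝ) - 1) ^ 2) := by
    rw [hA, hK]
    simp [Matrix.det_succ_row_zero, Fin.sum_univ_succ, Fin.succAbove]
    field_simp
    ring
  refine ⟨hdet, fun h3 hK0 => ?_⟩
  have h3' : (3 : ℝ) ≤ N := by exact_mod_cast h3
  have hp : -((N : ℝ) + 1) ≠ 0 := by linarith
  have h2 : (N : ℝ) - 2 ≠ 0 := by linarith
  rw [Matrix.isUnit_iff_isUnit_det, isUnit_iff_ne_zero, hdet]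
  exact div_ne_zero (mul_ne_zero (mul_ne_zero hp h2) hK0) (mul_ne_zero h0 (pow_ne_zero 2 h1))
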